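/- Every mixed ladder determinantal ideal I_t(L) ⊆ K[L] is a prime ideal. -/

import Mathlib

open MvPolynomial

/-- The data of a two-sided ladder inside an `m × n` matrix of indeterminates,
with upper outside corners `(b i, a i)` and lower outside corners `(d j, c j)`,
together with a vector `t` of minor sizes, subject to the standing assumptions. -/
structure LadderData where
  m : ℕ
  n : ℕ
  h : ℕ
  k : ℕ
  hpos : 0 < h
  kpos : 0 < k
  hmn : m ≤ n
  b : Fin h → ℕ
  a : Fin h → ℕ
  d : Fin k → ℕ
  c : Fin k → ℕ
  t : Fin k → ℕ
  b_mono : StrictMono b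
  a_mono : StrictMono a
  b_first : b ⟨0, hpos⟩ = 1
  b_le : ∀ i, b i ≤ m
  a_pos : ∀ i, 1 ≤ a i
  a_last : a ⟨h - 1, Nat.sub_lt hpos Nat.one_pos⟩ = n
  d_mono : Monotone d
  c_mono : Monotone c
  d_pos : ∀ j, 1 ≤ d j
  d_last : d ⟨k - 1, Nat.sub_lt kpos Nat.one_pos⟩ = m
  c_first : c ⟨0, kpos⟩ = 1
  c_le : ∀ j, c j ≤ n
  corners_distinct : ∀ j j' : Fin k, d j = d j' → c j = c j' → j = j'
  t_pos : ∀ j, 1 ≤ t j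
  step_d : ∀ (j : ℕ) (hj : j + 1 < k),
    d ⟨j, Nat.lt_of_succ_lt hj⟩ + t ⟨j + 1, hj⟩ < d ⟨j + 1, hj⟩ + t ⟨j, Nat.lt_of_succ_lt hj⟩
  step_c : ∀ (j : ℕ) (hj : j + 1 < k),
    c ⟨j, Nat.lt_of_succ_lt hj⟩ + t ⟨j, Nat.lt_of_succ_lt hj⟩ < c ⟨j + 1, hj⟩ + t ⟨j + 1, hj⟩

namespace LadderData

/-- The set of positions (row, column) of the indeterminates of the ladder `L`. -/
def L (D : LadderData) : Set (ℕ × ℕ) :=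
  {p | ∃ (i : Fin D.h) (j : Fin D.k),
    D.b i ≤ p.1 ∧ p.1 ≤ D.m ∧ 1 ≤ p.2 ∧ p.2 ≤ D.a i ∧
    1 ≤ p.1 ∧ p.1 ≤ D.d j ∧ D.c j ≤ p.2 ∧ p.2 ≤ D.n}

/-- The one-sided subladder `L_j` with lower outside corner `(d j, c j)`. -/
def Lj (D : LadderData) (j : Fin D.k) : Set (ℕ × ℕ) :=
  {p ∈ D.L | p.1 ≤ D.d j ∧ D.c j ≤ p.2}

end LadderData

/-- The ideal of `K[V]` (`V` a set of positions of indeterminates) generated by the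
`s × s` minors of the generic matrix all of whose entries lie in `S`. -/
noncomputable def minorsIdeal (K : Type*) [Field K] (V S : Set (ℕ × ℕ)) (s : ℕ) :
    Ideal (MvPolynomial ↥V K) :=
  Ideal.span {f | ∃ r cc : Fin s → ℕ, StrictMono r ∧ StrictMono cc ∧
    (∀ p q, (r p, cc q) ∈ S) ∧
    ∃ hmem : ∀ p q, ((r p, cc q) : ℕ × ℕ) ∈ V,
    f = (Matrix.of fun p q =>
      (MvPolynomial.X (⟨(r p, cc q), hmem p q⟩ : V) : MvPolynomial ↥V K)).det}

/-- The mixed ladder determinantal ideal `I_t(L) = I_{t_1}(L_1) + ⋯ + I_{t_k}(L_k) ⊆ K[L]`. -/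
noncomputable def LadderData.It (D : LadderData) (K : Type*) [Field K] :
    Ideal (MvPolynomial ↥D.L K) :=
  ⨆ j : Fin D.k, minorsIdeal K D.L (D.Lj j) (D.t j)

/-- Every entry of the ladder is involved in one of the minors generating `I_t(L)`. -/
def LadderData.Nondeg (D : LadderData) : Prop :=
  ∀ p ∈ D.L, ∃ (j : Fin D.k) (r cc : Fin (D.t j) → ℕ),
    StrictMono r ∧ StrictMono cc ∧ (∀ u v, (r u, cc v) ∈ D.Lj j) ∧ ∃ u v, (r u, cc v) = p

/-- A minor larger than a nonsingular block vanishes once all minors bordering that block do. -/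
theorem det_eq_zero_of_bordered {F : Type*} [Field F] (E : ℕ × ℕ → F) (s : ℕ) (R Q : Fin s → ℕ)
    (hRQ : (Matrix.of fun i j => E (R i, Q j)).det ≠ 0) (r q : Fin (s + 1) → ℕ)
    (hb : ∀ i j, (Matrix.of fun a b : Fin (s + 1) =>
      E ((Fin.cons (r i) R : Fin (s + 1) → ℕ) a, (Fin.cons (q j) Q : Fin (s + 1) → ℕ) b)).det = 0) :
    (Matrix.of fun i j => E (r i, q j)).det = 0 := by
  set B : Matrix (Fin s) (Fin s) F := Matrix.of fun i j => E (R i, Q j) with hB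
  let left : Matrix (Fin (s + 1)) (Fin s) F := Matrix.of fun i j => E (r i, Q j)
  let right : Matrix (Fin s) (Fin (s + 1)) F := Matrix.of fun i j => E (R i, q j)
  let e : Fin s ⊕ Unit ≃ Fin (s + 1) :=
    (Equiv.optionEquivSumPUnit (Fin s)).symm.trans (finSuccEquiv s).symm
  have hBu : IsUnit B.det := isUnit_iff_ne_zero.mpr hRQ
  let _ : Invertible B := Matrix.invertibleOfIsUnitDet B hBu
  have key : (Matrix.of fun i j => E (r i, q j)) = left * (⅟B * right) := by
    ext i j
    have h := hb i j
    rw [← Matrix.det_submatrix_equiv_self e] at h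
    have h2 : (Matrix.of fun a b : Fin (s + 1) =>
        E ((Fin.cons (r i) R : Fin (s + 1) → ℕ) a,
          (Fin.cons (q j) Q : Fin (s + 1) → ℕ) b)).submatrix e e =
        Matrix.fromBlocks B (Matrix.of fun a _ => right a j) (Matrix.of fun _ b => left i b)
          (Matrix.of fun _ _ => E (r i, q j)) := by
      ext a b
      rcases a with a | a <;> rcases b with b | b <;> simp [e, left, right, hB]
    rw [h2, Matrix.det_fromBlocks₁₁, mul_eq_zero, or_iff_right hRQ, Matrix.det_unique] at h
    rw [Matrix.sub_apply, sub_eq_zero] at h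
    rw [← Matrix.mul_assoc]
    simpa [Matrix.mul_apply] using h
  by_contra hne
  have h1 := Matrix.rank_of_isUnit (Matrix.of fun i j => E (r i, q j))
    ((Matrix.isUnit_iff_isUnit_det _).mpr (isUnit_iff_ne_zero.mpr hne))
  have h2 : (Matrix.of fun i j => E (r i, q j)).rank ≤ s := by
    rw [key]
    exact (Matrix.rank_mul_le_left _ _).trans (Matrix.rank_le_width _)
  simp at h1
  omega

open Polynomial in
/-- Clearing denominators when a polynomial is evaluated at a fraction. -/
theorem exists_pow_mul_eval₂_eq {A F : Type*} [CommRing A] [Field F] (f : A →+* F) (g r : A)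
    (hg : f g ≠ 0) (n : ℕ) (h : A[X]) (hn : h.natDegree ≤ n) :
    ∃ u : A, f g ^ n * h.eval₂ f (f r / f g) = f u := by
  refine ⟨∑ i ∈ Finset.range (n + 1), h.coeff i * r ^ i * g ^ (n - i), ?_⟩
  rw [Polynomial.eval₂_eq_sum_range' f (Nat.lt_succ_of_le hn), Finset.mul_sum, map_sum]
  refine Finset.sum_congr rfl fun i hi => ?_
  have hi' : i ≤ n := Nat.lt_succ_iff.mp (Finset.mem_range.mp hi)
  rw [map_mul, map_mul, map_pow, map_pow, div_pow]
  obtain ⟨k, rfl⟩ := Nat.exists_eq_add_of_le hi'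
  rw [Nat.add_sub_cancel_left, pow_add]
  field_simp

open Polynomial in
/-- Primality of an ideal of `A[X]` that is generated in degree at most one over a prime ideal `N`
of `A` and whose ideal `C` of leading coefficients is prime. -/
theorem isPrime_of_linear {A F : Type*} [CommRing A] [Field F] (f : A →+* F) (C : Ideal A)
    [hC : C.IsPrime] (J : Ideal A[X]) (g r : A) (hNC : RingHom.ker f ≤ C)
    (hgC : g ∈ C) (hg : f g ≠ 0) (hr : r ∉ C)
    (hNJ : ∀ a, f a = 0 → Polynomial.C a ∈ J)
    (hCJ : ∀ a ∈ C, ∃ b, Polynomial.C a * Polynomial.X + Polynomial.C b ∈ J)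
    (hJ : J ≤ RingHom.ker (Polynomial.eval₂RingHom f (f r / f g))) : J.IsPrime := by
  suffices h : J = RingHom.ker (Polynomial.eval₂RingHom f (f r / f g)) by
    rw [h]; exact RingHom.ker_isPrime _
  refine le_antisymm hJ ?_
  suffices h : ∀ n, ∀ p : A[X], p.natDegree ≤ n → p.eval₂ f (f r / f g) = 0 → p ∈ J from
    fun p hp => h p.natDegree p le_rfl hp
  intro n
  induction n with
  | zero =>
    intro p hp h0
    rw [Polynomial.eq_C_of_natDegree_le_zero hp] at h0 ⊢
    rw [Polynomial.eval₂_C] at h0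
    exact hNJ _ h0
  | succ n ih =>
    intro p hp h0
    set a := p.coeff (n + 1) with ha
    set h := p - Polynomial.C a * Polynomial.X ^ (n + 1) with hh
    have hph : p = h + Polynomial.C a * Polynomial.X ^ (n + 1) := by rw [hh]; ring
    have hdeg : h.natDegree ≤ n := by
      rw [Polynomial.natDegree_le_iff_coeff_eq_zero]
      intro N hN
      rw [hh, Polynomial.coeff_sub, Polynomial.coeff_C_mul_X_pow]
      split_ifs with hc
      · rw [hc, ha, sub_self]
      · rw [sub_zero]
        exact Polynomial.coeff_eq_zero_of_natDegree_lt (by omega)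
    obtain ⟨u, hu⟩ := exists_pow_mul_eval₂_eq f g r hg n h hdeg
    have haC : a ∈ C := by
      have h1 : f (g * u + a * r ^ (n + 1)) = 0 := by
        have h2 : f g ^ (n + 1) * p.eval₂ f (f r / f g) = 0 := by rw [h0, mul_zero]
        rw [hph] at h2
        simp only [Polynomial.eval₂_add, Polynomial.eval₂_mul, Polynomial.eval₂_C,
          Polynomial.eval₂_X_pow] at h2
        rw [map_add, map_mul, map_mul, map_pow, ← hu, ← h2, div_pow]
        field_simp
        ring
      have h3 : a * r ^ (n + 1) ∈ C :=
        (Ideal.add_mem_iff_right C (Ideal.mul_mem_right u C hgC)).mp (hNC h1)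
      exact (hC.mem_or_mem h3).resolve_right fun h => hr (hC.mem_of_pow_mem _ h)
    obtain ⟨b, hb⟩ := hCJ a haC
    have hb' := hJ hb
    rw [RingHom.mem_ker, Polynomial.coe_eval₂RingHom] at hb'
    have h4 : p - Polynomial.X ^ n * (Polynomial.C a * Polynomial.X + Polynomial.C b) ∈ J := by
      refine ih _ ?_ ?_
      · have : p - Polynomial.X ^ n * (Polynomial.C a * Polynomial.X + Polynomial.C b) =
            h - Polynomial.C b * Polynomial.X ^ n := by rw [hph]; ring
        rw [this]
        exact (Polynomial.natDegree_sub_le _ _).trans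
          (max_le hdeg (Polynomial.natDegree_C_mul_X_pow_le _ _))
      · rw [Polynomial.eval₂_sub, Polynomial.eval₂_mul, h0, hb', mul_zero, sub_zero]
    exact (Submodule.sub_mem_iff_left J (Ideal.mul_mem_left J _ hb)).mp h4

theorem isPrime_span_X_image {σ R : Type*} [CommRing R] [IsDomain R] (s : Set σ) :
    (Ideal.span ((X : σ → MvPolynomial σ R) '' s)).IsPrime := by
  classical
  let φ : MvPolynomial σ R →ₐ[R] MvPolynomial σ R := aeval fun v => if v ∈ s then 0 else X v
  suffices h : Ideal.span ((X : σ → MvPolynomial σ R) '' s) = RingHom.ker φ by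
    rw [h]; exact RingHom.ker_isPrime _
  refine le_antisymm ?_ fun p hp => ?_
  · rw [Ideal.span_le]
    rintro _ ⟨v, hv, rfl⟩
    simp [φ, hv]
  · have h : (Ideal.Quotient.mkₐ R (Ideal.span ((X : σ → MvPolynomial σ R) '' s))).comp φ =
        Ideal.Quotient.mkₐ R (Ideal.span ((X : σ → MvPolynomial σ R) '' s)) := by
      ext v
      by_cases hv : v ∈ s
      · have : Ideal.Quotient.mk (Ideal.span ((X : σ → MvPolynomial σ R) '' s)) (X v) = 0 :=
          Ideal.Quotient.eq_zero_iff_mem.mpr (Ideal.subset_span ⟨v, hv, rfl⟩)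
        simp [φ, hv, this]
      · simp [φ, hv]
    have h2 := DFunLike.congr_fun h p
    rw [RingHom.mem_ker] at hp
    rw [AlgHom.comp_apply, hp, map_zero] at h2
    exact Ideal.Quotient.eq_zero_iff_mem.mp h2.symm

theorem isPrime_of_isPrime_map {A B : Type*} [CommRing A] [CommRing B] (φ : A →+* B) (ψ : B →+* A)
    (h : ψ.comp φ = RingHom.id A) (I : Ideal A) (hI : (I.map φ).IsPrime) : I.IsPrime := by
  have : I = (I.map φ).comap φ := by
    refine le_antisymm Ideal.le_comap_map fun a ha => ?_
    have h1 := Ideal.mem_map_of_mem ψ (Ideal.mem_comap.mp ha)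
    rw [Ideal.map_map, h, Ideal.map_id, ← RingHom.comp_apply, h] at h1
    exact h1
  rw [this]
  exact Ideal.IsPrime.comap φ

theorem exists_add_card_le {t d : ℕ} (ht : 0 < t) (r : Fin t → ℕ) (hr : Function.Injective r)
    (hd : ∀ i, r i ≤ d) : ∃ i, r i + t ≤ d + 1 := by
  by_contra! h
  have hsub : Finset.univ.image r ⊆ Finset.Icc (d + 2 - t) d := by
    intro x hx
    obtain ⟨i, -, rfl⟩ := Finset.mem_image.mp hx
    have := h i
    exact Finset.mem_Icc.mpr ⟨by omega, hd i⟩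
  have := Finset.card_le_card hsub
  rw [Finset.card_image_of_injective _ hr, Finset.card_univ, Fintype.card_fin, Nat.card_Icc] at this
  omega

theorem exists_le_add_card {t c : ℕ} (ht : 0 < t) (q : Fin t → ℕ) (hq : Function.Injective q)
    (hc : ∀ j, c ≤ q j) : ∃ j, c + t ≤ q j + 1 := by
  by_contra! h
  have hsub : Finset.univ.image q ⊆ Finset.Ico c (c + t - 1) := by
    intro x hx
    obtain ⟨i, -, rfl⟩ := Finset.mem_image.mp hx
    have := h i
    exact Finset.mem_Ico.mpr ⟨hc i, by omega⟩
  have := Finset.card_le_card hsub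
  rw [Finset.card_image_of_injective _ hq, Finset.card_univ, Fintype.card_fin, Nat.card_Ico] at this
  omega

/-- The determinant of the submatrix of the generic matrix with the given rows and columns. -/
noncomputable def minor (K : Type*) [CommRing K] {s : ℕ} (r q : Fin s → ℕ) :
    MvPolynomial (ℕ × ℕ) K :=
  (Matrix.of fun i j => X (r i, q j)).det

section Minors

variable {K : Type*} [CommRing K]

theorem map_minor {B : Type*} [CommRing B] (φ : MvPolynomial (ℕ × ℕ) K →+* B) {s : ℕ}
    (r q : Fin s → ℕ) : φ (minor K r q) = (Matrix.of fun i j => φ (X (r i, q j))).det := by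
  rw [minor, RingHom.map_det]
  rfl

theorem minor_eq_zero_of_row {s : ℕ} (r q : Fin s → ℕ) (h : ¬ Function.Injective r) :
    minor K r q = 0 := by
  simp only [Function.Injective, not_forall] at h
  obtain ⟨i, j, hij, hne⟩ := h
  exact Matrix.det_zero_of_row_eq hne (by ext k; simp [hij])

theorem minor_eq_zero_of_col {s : ℕ} (r q : Fin s → ℕ) (h : ¬ Function.Injective q) :
    minor K r q = 0 := by
  simp only [Function.Injective, not_forall] at h
  obtain ⟨i, j, hij, hne⟩ := h
  exact Matrix.det_zero_of_column_eq hne (by intro k; simp [hij])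

/-- The entries with row indices `r` and column indices `q` lie in `U`, in rows at most `d` and
columns at least `c`. -/
def InBox (U : Set (ℕ × ℕ)) (d c : ℕ) {s : ℕ} (r q : Fin s → ℕ) : Prop :=
  (∀ i, r i ≤ d) ∧ (∀ j, c ≤ q j) ∧ ∀ i j, (r i, q j) ∈ U

/-- The ideal `I` contains the `t`-minors of the part of `U` in rows at most `d` and columns at
least `c`. -/
def ContainsMinors (I : Ideal (MvPolynomial (ℕ × ℕ) K)) (U : Set (ℕ × ℕ)) (d c t : ℕ) : Prop :=
  ∀ r q : Fin t → ℕ, InBox U d c r q → minor K r q ∈ I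

theorem ContainsMinors.mono {I : Ideal (MvPolynomial (ℕ × ℕ) K)} {U : Set (ℕ × ℕ)}
    {d c d' c' t : ℕ} (h : ContainsMinors I U d c t) (hd : d' ≤ d) (hc : c ≤ c') :
    ContainsMinors I U d' c' t := fun r q hrq =>
  h r q ⟨fun i => (hrq.1 i).trans hd, fun j => hc.trans (hrq.2.1 j), hrq.2.2⟩

theorem ContainsMinors.succ_row {I : Ideal (MvPolynomial (ℕ × ℕ) K)} {U : Set (ℕ × ℕ)}
    {d c t : ℕ} (h : ContainsMinors I U d c t) : ContainsMinors I U (d + 1) c (t + 1) := by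
  intro r q hrq
  by_cases hr : Function.Injective r
  · obtain ⟨i, hi⟩ : ∃ i, ∀ k, k ≠ i → r k ≤ d := by
      by_cases hex : ∃ i, r i = d + 1
      · obtain ⟨i, hi⟩ := hex
        refine ⟨i, fun k hk => ?_⟩
        have h1 := hrq.1 k
        have h2 : r k ≠ r i := fun h => hk (hr h)
        omega
      · refine ⟨0, fun k _ => ?_⟩
        have h1 := hrq.1 k
        have h2 : r k ≠ d + 1 := fun h => hex ⟨k, h⟩
        omega
    rw [minor, Matrix.det_succ_row _ i]
    refine Ideal.sum_mem _ fun j _ => Ideal.mul_mem_left _ _ ?_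
    exact h (r ∘ i.succAbove) (q ∘ j.succAbove)
      ⟨fun k => hi _ (Fin.succAbove_ne i k), fun k => hrq.2.1 _, fun _ _ => hrq.2.2 _ _⟩
  · rw [minor_eq_zero_of_row r q hr]
    exact I.zero_mem

theorem ContainsMinors.succ_col {I : Ideal (MvPolynomial (ℕ × ℕ) K)} {U : Set (ℕ × ℕ)}
    {d c t : ℕ} (h : ContainsMinors I U d (c + 1) t) : ContainsMinors I U d c (t + 1) := by
  intro r q hrq
  by_cases hq : Function.Injective q
  · obtain ⟨i, hi⟩ : ∃ i, ∀ k, k ≠ i → c + 1 ≤ q k := by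
      by_cases hex : ∃ i, q i = c
      · obtain ⟨i, hi⟩ := hex
        refine ⟨i, fun k hk => ?_⟩
        have h1 := hrq.2.1 k
        have h2 : q k ≠ q i := fun h => hk (hq h)
        omega
      · refine ⟨0, fun k _ => ?_⟩
        have h1 := hrq.2.1 k
        have h2 : q k ≠ c := fun h => hex ⟨k, h⟩
        omega
    rw [minor, Matrix.det_succ_column _ i]
    refine Ideal.sum_mem _ fun j _ => Ideal.mul_mem_left _ _ ?_
    exact h (r ∘ j.succAbove) (q ∘ i.succAbove)
      ⟨fun k => hrq.1 _, fun k => hi _ (Fin.succAbove_ne i k), fun _ _ => hrq.2.2 _ _⟩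
  · rw [minor_eq_zero_of_col r q hq]
    exact I.zero_mem

theorem ContainsMinors.add_row {I : Ideal (MvPolynomial (ℕ × ℕ) K)} {U : Set (ℕ × ℕ)}
    {d c t : ℕ} (h : ContainsMinors I U d c t) (e : ℕ) :
    ContainsMinors I U (d + e) c (t + e) := by
  induction e with
  | zero => exact h
  | succ e ih => exact ih.succ_row

theorem ContainsMinors.add_col {I : Ideal (MvPolynomial (ℕ × ℕ) K)} {U : Set (ℕ × ℕ)}
    {d c t : ℕ} (e : ℕ) (h : ContainsMinors I U d (c + e) t) :
    ContainsMinors I U d c (t + e) := by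
  induction e generalizing t with
  | zero => exact h
  | succ e ih =>
    have := ih (ContainsMinors.succ_col h)
    rwa [add_right_comm] at this

/-- A rank condition: the `t`-minors in rows at most `d` and columns at least `c` vanish. -/
structure Corner where
  d : ℕ
  c : ℕ
  t : ℕ

variable (K) in
/-- The ideal generated by the minors prescribed by the rank conditions `S`, with entries in `U`. -/
noncomputable def rankIdeal (U : Set (ℕ × ℕ)) (S : Set Corner) : Ideal (MvPolynomial (ℕ × ℕ) K) :=
  Ideal.span {f | ∃ p ∈ S, ∃ r q : Fin p.t → ℕ, InBox U p.d p.c r q ∧ minor K r q = f}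

theorem containsMinors_rankIdeal {U : Set (ℕ × ℕ)} {S : Set Corner} {p : Corner} (hp : p ∈ S) :
    ContainsMinors (rankIdeal K U S) U p.d p.c p.t := fun r q hrq =>
  Ideal.subset_span ⟨p, hp, r, q, hrq, rfl⟩

theorem rankIdeal_le_iff {U : Set (ℕ × ℕ)} {S : Set Corner} {I : Ideal (MvPolynomial (ℕ × ℕ) K)} :
    rankIdeal K U S ≤ I ↔ ∀ p ∈ S, ContainsMinors I U p.d p.c p.t := by
  rw [rankIdeal, Ideal.span_le]
  constructor
  · intro h p hp r q hrq
    exact h ⟨p, hp, r, q, hrq, rfl⟩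
  · rintro h _ ⟨p, hp, r, q, hrq, rfl⟩
    exact h p hp r q hrq

/-- Minors vanish at a point at which each relevant submatrix has a zero row or a zero column. -/
theorem containsMinors_ker_eval {U : Set (ℕ × ℕ)} {d c t : ℕ} (x : ℕ × ℕ → K)
    (h : ∀ r q : Fin t → ℕ, Function.Injective r → Function.Injective q → InBox U d c r q →
      (∃ a, ∀ b, x (r a, q b) = 0) ∨ ∃ b, ∀ a, x (r a, q b) = 0) :
    ContainsMinors (RingHom.ker (eval x)) U d c t := by
  intro r q hrq
  rw [RingHom.mem_ker]
  by_cases hr : Function.Injective r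
  · by_cases hq : Function.Injective q
    · rw [map_minor]
      rcases h r q hr hq hrq with ⟨a, ha⟩ | ⟨b, hb⟩
      · exact Matrix.det_eq_zero_of_row_eq_zero a fun b => by simp [ha b]
      · exact Matrix.det_eq_zero_of_column_eq_zero b fun a => by simp [hb a]
    · rw [minor_eq_zero_of_col r q hq, map_zero]
  · rw [minor_eq_zero_of_row r q hr, map_zero]

variable (K) in
/-- Single out the variable `y`: polynomials as univariate polynomials in `y`. -/
noncomputable def isolate (y : ℕ × ℕ) :
    MvPolynomial (ℕ × ℕ) K →+* Polynomial (MvPolynomial (ℕ × ℕ) K) :=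
  eval₂Hom (Polynomial.C.comp C) fun v => if v = y then Polynomial.X else Polynomial.C (X v)

@[simp]
theorem isolate_X (y v : ℕ × ℕ) :
    isolate K y (X v) = if v = y then Polynomial.X else Polynomial.C (X v) := by
  simp [isolate]

@[simp]
theorem isolate_C (y : ℕ × ℕ) (a : K) : isolate K y (C a) = Polynomial.C (C a) := by
  simp [isolate]

theorem eval_comp_isolate (y : ℕ × ℕ) :
    (Polynomial.evalRingHom (X y)).comp (isolate K y) = RingHom.id _ := by
  ext v
  · simp
  · by_cases h : v = y <;> simp [h]

theorem isolate_minor_of_ne (y : ℕ × ℕ) {s : ℕ} (r q : Fin s → ℕ) (h : ∀ i j, (r i, q j) ≠ y) :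
    isolate K y (minor K r q) = Polynomial.C (minor K r q) := by
  rw [map_minor, map_minor]
  congr
  ext i j : 2
  simp [h i j]

theorem exists_isolate_minor_eq (y : ℕ × ℕ) {s : ℕ} (r q : Fin (s + 1) → ℕ) (h0 : (r 0, q 0) = y)
    (h : ∀ i j, (i ≠ 0 ∨ j ≠ 0) → (r i, q j) ≠ y) :
    ∃ b, isolate K y (minor K r q) =
      Polynomial.C (minor K (r ∘ Fin.succ) (q ∘ Fin.succ)) * Polynomial.X + Polynomial.C b := by
  have hsub : ∀ i : Fin (s + 1), isolate K y (minor K (r ∘ i.succAbove) (q ∘ Fin.succ)) =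
      Polynomial.C (minor K (r ∘ i.succAbove) (q ∘ Fin.succ)) := fun i =>
    isolate_minor_of_ne _ _ _ fun _ b => h _ _ (Or.inr (Fin.succ_ne_zero b))
  have hexp : minor K r q = ∑ i : Fin (s + 1), (-1) ^ (i : ℕ) * X (r i, q 0) *
      minor K (r ∘ i.succAbove) (q ∘ Fin.succ) := by
    rw [minor, Matrix.det_succ_column_zero]
    rfl
  refine ⟨∑ i : Fin s, (-1) ^ (i.succ : ℕ) * X (r i.succ, q 0) *
      minor K (r ∘ i.succ.succAbove) (q ∘ Fin.succ), ?_⟩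
  rw [hexp, map_sum, Fin.sum_univ_succ, map_sum]
  congr 1
  · rw [map_mul, hsub, map_mul, isolate_X, if_pos h0]
    rw [Fin.succAbove_zero, Fin.val_zero, pow_zero, map_one, one_mul, mul_comm]
  · refine Finset.sum_congr rfl fun i _ => ?_
    rw [map_mul, hsub, map_mul, isolate_X, if_neg (h _ _ (Or.inl (Fin.succ_ne_zero i)))]
    simp only [map_mul, map_pow, map_neg, map_one]

end Minors

/-- A corner of a system of rank conditions can be adjoined to a prime ideal `N` that contains all
minors avoiding the corner entry, provided the ideal `C` of leading coefficients in the corner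
variable is prime. -/
theorem isPrime_rankIdeal_insert {K : Type*} [Field K] {U : Set (ℕ × ℕ)}
    (hU : ∀ a b a' b', (a, b) ∈ U → a ≤ a' → b' ≤ b → (a', b') ∈ U) (S T : Set Corner)
    (d c s : ℕ) (hsd : s ≤ d) (hcorner : (d - s, c + s + 1) ∈ U)
    (hy : ∀ i ∈ S, i.d ≤ d ∨ c + 1 ≤ i.c)
    (hsep : ∀ i ∈ S, 0 < i.t ∧ (i.d + (s + 2) < d + 1 + i.t ∨ c + (s + 2) < i.c + i.t))
    (hT : ∀ i ∈ T, i ∈ S ∨ i = ⟨d, c, s + 2⟩ ∨ i = ⟨d + 1, c + 1, s + 2⟩)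
    (hST : S ⊆ T) (hrow : ContainsMinors (rankIdeal K U T) U d c (s + 2))
    (hcol : ContainsMinors (rankIdeal K U T) U (d + 1) (c + 1) (s + 2))
    (hTprime : (rankIdeal K U T).IsPrime)
    (hCprime : (rankIdeal K U (insert ⟨d, c + 1, s + 1⟩ S)).IsPrime) :
    (rankIdeal K U (insert ⟨d + 1, c, s + 2⟩ S)).IsPrime := by
  set y : ℕ × ℕ := (d + 1, c) with hydef
  set N := rankIdeal K U T with hN
  set L := rankIdeal K U (insert ⟨d, c + 1, s + 1⟩ S) with hL
  set I := rankIdeal K U (insert ⟨d + 1, c, s + 2⟩ S) with hI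
  have hIc : ContainsMinors I U (d + 1) c (s + 2) :=
    containsMinors_rankIdeal (Set.mem_insert _ _)
  have hIS : ∀ i ∈ S, ContainsMinors I U i.d i.c i.t := fun i hi =>
    containsMinors_rankIdeal (Set.mem_insert_of_mem _ hi)
  have hLc : ContainsMinors L U d (c + 1) (s + 1) :=
    containsMinors_rankIdeal (Set.mem_insert _ _)
  have hLS : ∀ i ∈ S, ContainsMinors L U i.d i.c i.t := fun i hi =>
    containsMinors_rankIdeal (Set.mem_insert_of_mem _ hi)
  -- entries of a box avoid `y`
  have hne : ∀ {d' c' t : ℕ} {r q : Fin t → ℕ}, InBox U d' c' r q → (d' ≤ d ∨ c + 1 ≤ c') →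
      ∀ i j, (r i, q j) ≠ y := by
    intro d' c' t r q hrq h i j hij
    have h1 := hrq.1 i
    have h2 := hrq.2.1 j
    rw [hydef, Prod.mk.injEq] at hij
    omega
  have hTne : ∀ i ∈ T, i.d ≤ d ∨ c + 1 ≤ i.c := by
    intro i hi
    rcases hT i hi with h | rfl | rfl
    · exact hy i h
    · exact Or.inl le_rfl
    · exact Or.inr le_rfl
  have hNL : N ≤ L := by
    rw [hN, rankIdeal_le_iff]
    intro i hi
    rcases hT i hi with h | rfl | rfl
    · exact hLS i h
    · exact hLc.succ_col
    · exact hLc.succ_row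
  have hNI : N ≤ I := by
    rw [hN, rankIdeal_le_iff]
    intro i hi
    rcases hT i hi with h | rfl | rfl
    · exact hIS i h
    · exact hIc.mono (Nat.le_succ _) le_rfl
    · exact hIc.mono le_rfl (Nat.le_succ _)
  -- the compact minor at the corner and its cofactor
  let R : Fin (s + 1) → ℕ := fun i => d - i
  let Q : Fin (s + 1) → ℕ := fun j => c + 1 + j
  let ρ : Fin (s + 2) → ℕ := Fin.cons (d + 1) R
  let γ : Fin (s + 2) → ℕ := Fin.cons c Q
  have hρ : ∀ i, ρ i = d + 1 - i := by
    intro i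
    refine Fin.cases ?_ (fun i => ?_) i
    · simp [ρ]
    · simp [ρ, R]
  have hγ : ∀ j, γ j = c + j := by
    intro i
    refine Fin.cases ?_ (fun i => ?_) i
    · simp [γ]
    · simp [γ, Q]; omega
  have hbox0 : InBox U (d + 1) c ρ γ := by
    refine ⟨fun i => ?_, fun j => ?_, fun i j => ?_⟩
    · rw [hρ]; omega
    · rw [hγ]; omega
    · rw [hρ, hγ]
      exact hU _ _ _ _ hcorner (by omega) (by omega)
  have hboxg : InBox U d (c + 1) R Q := by
    refine ⟨fun i => ?_, fun j => ?_, fun i j => ?_⟩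
    · simp [R]
    · simp [Q]
    · exact hU _ _ _ _ hcorner (by simp only [R]; omega) (by simp only [Q]; omega)
  obtain ⟨b₀, hb₀⟩ := exists_isolate_minor_eq (K := K) y ρ γ (by simp [ρ, γ, hydef]) (by
    intro i j hij h
    rw [hρ, hγ, hydef, Prod.mk.injEq] at h
    rw [← Fin.val_ne_zero_iff, ← Fin.val_ne_zero_iff] at hij
    omega)
  have hρs : ρ ∘ Fin.succ = R := by ext i; simp [ρ]
  have hγs : γ ∘ Fin.succ = Q := by ext i; simp [γ]
  rw [hρs, hγs] at hb₀
  -- two test points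
  have hcount : ∀ i ∈ S, ∀ r q : Fin i.t → ℕ, Function.Injective r → Function.Injective q →
      InBox U i.d i.c r q → (∃ a, r a + s + 1 ≤ d) ∨ ∃ b, c + s + 2 ≤ q b := by
    intro i hi r q hr hq hrq
    obtain ⟨ht, h⟩ := hsep i hi
    rcases h with h | h
    · obtain ⟨a, ha⟩ := exists_add_card_le ht r hr hrq.1
      exact Or.inl ⟨a, by omega⟩
    · obtain ⟨b, hb⟩ := exists_le_add_card ht q hq hrq.2.1
      exact Or.inr ⟨b, by omega⟩
  have hgN : minor K R Q ∉ N := by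
    let x : ℕ × ℕ → K := fun v => if v.1 + v.2 = d + c + 1 ∧ d ≤ v.1 + s ∧ v.2 ≤ c + s + 1
      then 1 else 0
    have hker : N ≤ RingHom.ker (eval x) := by
      rw [hN, rankIdeal_le_iff]
      intro i hi
      apply containsMinors_ker_eval
      intro r q hr hq hrq
      have : (∃ a, r a + s + 1 ≤ d) ∨ ∃ b, c + s + 2 ≤ q b := by
        rcases hT i hi with h | rfl | rfl
        · exact hcount i h r q hr hq hrq
        · obtain ⟨a, ha⟩ := exists_add_card_le (Nat.succ_pos _) r hr hrq.1
          exact Or.inl ⟨a, by simp only at ha; omega⟩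
        · obtain ⟨b, hb⟩ := exists_le_add_card (Nat.succ_pos _) q hq hrq.2.1
          exact Or.inr ⟨b, by simp only at hb; omega⟩
      rcases this with ⟨a, ha⟩ | ⟨b, hb⟩
      · exact Or.inl ⟨a, fun b => if_neg (by simp only; omega)⟩
      · exact Or.inr ⟨b, fun a => if_neg (by simp only; omega)⟩
    intro h
    have h1 := hker h
    rw [RingHom.mem_ker, map_minor] at h1
    have h2 : (Matrix.of fun i j : Fin (s + 1) => eval x (X (R i, Q j))) = 1 := by
      ext i j
      simp only [Matrix.of_apply, eval_X, x, R, Q, Matrix.one_apply]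
      refine if_congr ?_ rfl rfl
      rw [Fin.ext_iff]
      omega
    rw [h2, Matrix.det_one] at h1
    exact one_ne_zero h1
  have hbL : -b₀ ∉ L := by
    let x : ℕ × ℕ → K := fun v => if v.1 + s = v.2 + d - c ∧ c ≤ v.2 ∧ v.2 ≤ c + s + 1
      then 1 else 0
    have hker : L ≤ RingHom.ker (eval x) := by
      rw [hL, rankIdeal_le_iff]
      intro i hi
      apply containsMinors_ker_eval
      intro r q hr hq hrq
      rcases hi with rfl | hi
      · obtain ⟨a, ha⟩ := exists_add_card_le (Nat.succ_pos _) r hr hrq.1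
        refine Or.inl ⟨a, fun b => if_neg ?_⟩
        have := hrq.2.1 b
        simp only at ha this ⊢
        omega
      · rcases hcount i hi r q hr hq hrq with ⟨a, ha⟩ | ⟨b, hb⟩
        · exact Or.inl ⟨a, fun b => if_neg (by simp only; omega)⟩
        · exact Or.inr ⟨b, fun a => if_neg (by simp only; omega)⟩
    intro h
    have h1 := hker (neg_mem_iff.mp h)
    rw [RingHom.mem_ker] at h1
    have hcomp : (Polynomial.eval₂RingHom (eval x) 0).comp (isolate K y) = eval x := by
      ext v
      · simp
      · by_cases hv : v = y
        · subst hv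
          have : x y = 0 := if_neg (by simp only [hydef]; omega)
          simp [this]
        · simp [hv]
    have h2 := congrArg (Polynomial.eval₂RingHom (eval x) 0) hb₀
    rw [← RingHom.comp_apply, hcomp] at h2
    simp only [Polynomial.coe_eval₂RingHom, Polynomial.eval₂_add, Polynomial.eval₂_mul,
      Polynomial.eval₂_C, Polynomial.eval₂_X, mul_zero, zero_add, h1] at h2
    rw [map_minor] at h2
    have h3 : (Matrix.of fun i j : Fin (s + 2) => eval x (X (ρ i, γ j))) =
        (1 : Matrix _ _ K).submatrix id Fin.revPerm := by
      ext i j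
      simp only [Matrix.of_apply, eval_X, x, hρ, hγ, Matrix.submatrix_apply, Matrix.one_apply,
        id, Fin.revPerm_apply]
      refine if_congr ?_ rfl rfl
      rw [Fin.ext_iff, Fin.val_rev]
      omega
    rw [h3, Matrix.det_permute', Matrix.det_one, mul_one] at h2
    rcases Int.units_eq_one_or (Equiv.Perm.sign (Fin.revPerm : Equiv.Perm (Fin (s + 2))))
      with h4 | h4 <;> rw [h4] at h2 <;> simp at h2
  -- the ideal in isolated form
  let F := FractionRing (MvPolynomial (ℕ × ℕ) K ⧸ N)
  let f : MvPolynomial (ℕ × ℕ) K →+* F :=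
    (algebraMap (MvPolynomial (ℕ × ℕ) K ⧸ N) F).comp (Ideal.Quotient.mk N)
  have hf : ∀ a, f a = 0 ↔ a ∈ N := by
    intro a
    rw [← Ideal.Quotient.eq_zero_iff_mem]
    exact map_eq_zero_iff (algebraMap (MvPolynomial (ℕ × ℕ) K ⧸ N) F)
      (IsFractionRing.injective _ F)
  have hNJ : N ≤ (I.map (isolate K y)).comap Polynomial.C := by
    rw [hN, rankIdeal_le_iff]
    intro i hi r q hrq
    rw [Ideal.mem_comap, ← isolate_minor_of_ne y r q (hne hrq (hTne i hi))]
    exact Ideal.mem_map_of_mem _ (hNI (containsMinors_rankIdeal hi r q hrq))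
  apply isPrime_of_isPrime_map (isolate K y) _ (eval_comp_isolate y)
  apply isPrime_of_linear f L _ (minor K R Q) (-b₀) (fun a ha => hNL ((hf a).mp ha))
    (hLc R Q hboxg) (fun h => hgN ((hf _).mp h)) hbL (fun a ha => hNJ ((hf a).mp ha))
  · intro a ha
    induction ha using Submodule.span_induction with
    | zero => exact ⟨0, by simp⟩
    | add a a' _ _ h h' =>
      obtain ⟨b, hb⟩ := h
      obtain ⟨b', hb'⟩ := h'
      refine ⟨b + b', ?_⟩
      convert Ideal.add_mem _ hb hb' using 1
      rw [map_add, map_add]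
      ring
    | smul u a _ h =>
      obtain ⟨b, hb⟩ := h
      refine ⟨u * b, ?_⟩
      convert Ideal.mul_mem_left _ (Polynomial.C u) hb using 1
      rw [smul_eq_mul, map_mul, map_mul]
      ring
    | mem a ha =>
      obtain ⟨i, hi, r, q, hrq, rfl⟩ := ha
      rcases hi with rfl | hi
      · obtain ⟨b, hb⟩ := exists_isolate_minor_eq (K := K) y (Fin.cons (d + 1) r) (Fin.cons c q)
          (by simp [hydef]) (by
            intro i j hij h
            rw [hydef, Prod.mk.injEq] at h
            obtain ⟨h1, h2⟩ := h
            rcases hij with hij | hij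
            · obtain ⟨k, rfl⟩ := Fin.exists_succ_eq.mpr hij
              have := hrq.1 k
              simp at h1 this
              omega
            · obtain ⟨k, rfl⟩ := Fin.exists_succ_eq.mpr hij
              have := hrq.2.1 k
              simp at h2 this
              omega)
        refine ⟨b, ?_⟩
        have h1 : (Fin.cons (d + 1) r : Fin (s + 2) → ℕ) ∘ Fin.succ = r := by ext i; simp
        have h2 : (Fin.cons c q : Fin (s + 2) → ℕ) ∘ Fin.succ = q := by ext i; simp
        rw [h1, h2] at hb
        rw [← hb]
        refine Ideal.mem_map_of_mem _ (hIc _ _ ⟨fun i => ?_, fun j => ?_, fun i j => ?_⟩)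
        · refine Fin.cases (by simp) (fun i => ?_) i
          exact (hrq.1 i).trans (Nat.le_succ _)
        · refine Fin.cases (by simp) (fun j => ?_) j
          exact (Nat.le_succ _).trans (hrq.2.1 j)
        · refine Fin.cases ?_ (fun i => ?_) i <;> refine Fin.cases ?_ (fun j => ?_) j
          · exact hU _ _ _ _ (hrq.2.2 0 0) ((hrq.1 0).trans (Nat.le_succ _))
              ((Nat.le_succ _).trans (hrq.2.1 0))
          · exact hU _ _ _ _ (hrq.2.2 0 j) ((hrq.1 0).trans (Nat.le_succ _)) le_rfl
          · exact hU _ _ _ _ (hrq.2.2 i 0) le_rfl ((Nat.le_succ _).trans (hrq.2.1 0))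
          · exact hrq.2.2 i j
      · refine ⟨0, ?_⟩
        rw [map_zero, add_zero, ← isolate_minor_of_ne y r q (hne hrq (hy i hi))]
        exact Ideal.mul_mem_right _ _ (Ideal.mem_map_of_mem _ (hIS i hi r q hrq))
  · set Φ := Polynomial.eval₂RingHom f (f (-b₀) / f (minor K R Q)) with hΦ
    rw [Ideal.map_le_iff_le_comap, hI, rankIdeal_le_iff]
    have hgf : f (minor K R Q) ≠ 0 := fun h => hgN ((hf _).mp h)
    have hΦne : ∀ {t : ℕ} (r q : Fin t → ℕ), (∀ i j, (r i, q j) ≠ y) →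
        Φ (isolate K y (minor K r q)) = f (minor K r q) := by
      intro t r q h
      rw [isolate_minor_of_ne y r q h]
      simp [hΦ]
    have hΦ0 : Φ (isolate K y (minor K ρ γ)) = 0 := by
      rw [hb₀, hΦ]
      simp only [Polynomial.coe_eval₂RingHom, Polynomial.eval₂_add, Polynomial.eval₂_mul,
        Polynomial.eval₂_C, Polynomial.eval₂_X]
      rw [mul_div_cancel₀ _ hgf, map_neg, neg_add_cancel]
    intro i hi r q hrq
    rw [Ideal.mem_comap, RingHom.mem_ker]
    rcases hi with rfl | hi
    · by_cases hr : Function.Injective r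
      · by_cases hq : Function.Injective q
        · obtain ⟨i₀, hi₀⟩ := exists_add_card_le (Nat.succ_pos _) r hr hrq.1
          obtain ⟨j₀, hj₀⟩ := exists_le_add_card (Nat.succ_pos _) q hq hrq.2.1
          simp only at hi₀ hj₀
          let E : ℕ × ℕ → F := fun v => Φ (isolate K y (X v))
          have hE : ∀ {t : ℕ} (r q : Fin t → ℕ),
              (Matrix.of fun i j => E (r i, q j)).det = Φ (isolate K y (minor K r q)) :=
            fun r q => (map_minor (Φ.comp (isolate K y)) r q).symm
          rw [← hE]
          apply det_eq_zero_of_bordered E (s + 1) R Q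
          · rw [hE, hΦne R Q (hne hboxg (Or.inl le_rfl))]
            exact hgf
          · intro i j
            rw [hE]
            have hbox : InBox U (d + 1) c (Fin.cons (r i) R : Fin (s + 2) → ℕ)
                (Fin.cons (q j) Q) := by
              refine ⟨fun a => ?_, fun b => ?_, fun a b => ?_⟩
              · refine Fin.cases (hrq.1 i) (fun a => ?_) a
                exact (hboxg.1 a).trans (Nat.le_succ _)
              · refine Fin.cases (hrq.2.1 j) (fun b => ?_) b
                exact (Nat.le_succ _).trans (hboxg.2.1 b)
              · refine Fin.cases ?_ (fun a => ?_) a <;> refine Fin.cases ?_ (fun b => ?_) b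
                · exact hrq.2.2 i j
                · exact hU _ _ _ _ (hrq.2.2 i j₀) le_rfl
                    (by simp only [Q, Fin.cons_succ]; omega)
                · exact hU _ _ _ _ (hrq.2.2 i₀ j) (by simp only [R, Fin.cons_succ]; omega) le_rfl
                · exact hboxg.2.2 a b
            by_cases hri : r i = d + 1
            · by_cases hqj : q j = c
              · rw [hri, hqj]
                exact hΦ0
              · have hbox' : InBox U (d + 1) (c + 1) (Fin.cons (r i) R : Fin (s + 2) → ℕ)
                    (Fin.cons (q j) Q) := by
                  refine ⟨hbox.1, fun b => ?_, hbox.2.2⟩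
                  refine Fin.cases ?_ (fun b => hboxg.2.1 b) b
                  have := hrq.2.1 j
                  simp only [Fin.cons_zero] at this ⊢
                  omega
                rw [hΦne _ _ (hne hbox' (Or.inr le_rfl)), hf]
                exact hcol _ _ hbox'
            · have hbox' : InBox U d c (Fin.cons (r i) R : Fin (s + 2) → ℕ)
                  (Fin.cons (q j) Q) := by
                refine ⟨fun a => ?_, hbox.2⟩
                refine Fin.cases ?_ (fun a => hboxg.1 a) a
                have := hrq.1 i
                simp only [Fin.cons_zero] at this ⊢
                omega
              rw [hΦne _ _ (hne hbox' (Or.inl le_rfl)), hf]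
              exact hrow _ _ hbox'
        · rw [minor_eq_zero_of_col r q hq, map_zero, map_zero]
      · rw [minor_eq_zero_of_row r q hr, map_zero, map_zero]
    · rw [hΦne r q (hne hrq (hy i hi)), hf]
      exact containsMinors_rankIdeal (hST hi) r q hrq

theorem containsMinors_of_vacuous {K : Type*} [CommRing K] {U : Set (ℕ × ℕ)}
    (hU : ∀ a b a' b', (a, b) ∈ U → a ≤ a' → b' ≤ b → (a', b') ∈ U) {d c t : ℕ} (ht : 1 ≤ t)
    (h : ¬ (t ≤ d + 1 ∧ (d + 1 - t, c + t - 1) ∈ U)) (I : Ideal (MvPolynomial (ℕ × ℕ) K)) :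
    ContainsMinors I U d c t := by
  intro r q hrq
  by_cases hr : Function.Injective r
  · by_cases hq : Function.Injective q
    · obtain ⟨a, ha⟩ := exists_add_card_le ht r hr hrq.1
      obtain ⟨b, hb⟩ := exists_le_add_card ht q hq hrq.2.1
      exact absurd ⟨by omega, hU _ _ _ _ (hrq.2.2 a b) (by omega) (by omega)⟩ h
    · rw [minor_eq_zero_of_col r q hq]
      exact I.zero_mem
  · rw [minor_eq_zero_of_row r q hr]
    exact I.zero_mem

namespace Corner

/-- The order in which the corners of a mixed ladder follow each other. -/
def Precedes (p q : Corner) : Prop :=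
  p.d ≤ q.d ∧ p.c ≤ q.c ∧ p.d + q.t < q.d + p.t ∧ p.c + p.t < q.c + q.t

/-- Any two distinct corners in `S` follow each other. -/
def IsLadder (S : Finset Corner) : Prop :=
  ∀ p ∈ S, ∀ q ∈ S, p ≠ q → p.Precedes q ∨ q.Precedes p

theorem IsLadder.mono {S T : Finset Corner} (hT : IsLadder T) (h : S ⊆ T) : IsLadder S :=
  fun p hp q hq => hT p (h hp) q (h hq)

open Classical in
theorem IsLadder.insert {S : Finset Corner} (hS : IsLadder S) {p : Corner}
    (hp : ∀ q ∈ S, p.Precedes q ∨ q.Precedes p) : IsLadder (insert p S) := by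
  intro a ha b hb hab
  rcases Finset.mem_insert.mp ha with rfl | ha' <;> rcases Finset.mem_insert.mp hb with rfl | hb'
  · exact absurd rfl hab
  · exact hp b hb'
  · exact (hp a ha').symm
  · exact hS a ha' b hb' hab

open Classical in
theorem IsLadder.exists_extend (K : Type*) [CommRing K] {U : Set (ℕ × ℕ)} {S : Finset Corner}
    (hS : IsLadder S) (p : Corner)
    (hp : ∀ q ∈ S, (p.Precedes q ∨ q.Precedes p) ∨
      ∀ I : Ideal (MvPolynomial (ℕ × ℕ) K),
        ContainsMinors I U q.d q.c q.t → ContainsMinors I U p.d p.c p.t) :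
    ∃ T, IsLadder T ∧ S ⊆ T ∧ T ⊆ Insert.insert p S ∧
      ContainsMinors (rankIdeal K U T) U p.d p.c p.t := by
  by_cases h : ∀ q ∈ S, p.Precedes q ∨ q.Precedes p
  · exact ⟨Insert.insert p S, hS.insert h, Finset.subset_insert _ _, subset_rfl,
      containsMinors_rankIdeal (by simp)⟩
  · push Not at h
    obtain ⟨q, hq, hn⟩ := h
    refine ⟨S, hS, subset_rfl, Finset.subset_insert _ _, ?_⟩
    exact (hp q hq).resolve_left (by tauto) _ (containsMinors_rankIdeal hq)

/-- A weight that drops when a corner is pushed into the ladder. -/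
def weight (n : ℕ) (p : Corner) : ℕ := 3 ^ (p.d + (n + 1 - p.c))

open Classical in
theorem sum_weight_le {S T : Finset Corner} {p : Corner} (n : ℕ) (h : T ⊆ insert p S) :
    ∑ i ∈ T, i.weight n ≤ p.weight n + ∑ i ∈ S, i.weight n := by
  refine (Finset.sum_le_sum_of_subset h).trans ?_
  by_cases hp : p ∈ S
  · rw [Finset.insert_eq_of_mem hp]
    exact Nat.le_add_left _ _
  · rw [Finset.sum_insert hp]

end Corner

open Corner in
open Classical in
theorem isPrime_rankIdeal (K : Type*) [Field K] {U : Set (ℕ × ℕ)}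
    (hU : ∀ a b a' b', (a, b) ∈ U → a ≤ a' → b' ≤ b → (a', b') ∈ U) (n : ℕ)
    (hn : ∀ v ∈ U, v.2 ≤ n) (S : Finset Corner) (hS : IsLadder S) (ht : ∀ p ∈ S, 1 ≤ p.t) :
    (rankIdeal K U S).IsPrime := by
  induction hm : ∑ i ∈ S, i.weight n using Nat.strong_induction_on generalizing S with
  | _ m ih =>
  subst hm
  by_cases h1 : ∀ p ∈ S, p.t = 1
  · have : rankIdeal K U S =
        Ideal.span (X '' {v | v ∈ U ∧ ∃ p ∈ S, v.1 ≤ p.d ∧ p.c ≤ v.2}) := by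
      refine le_antisymm ?_ ?_
      · rw [rankIdeal_le_iff]
        rintro ⟨d, c, t⟩ hp r q hrq
        obtain rfl : t = 1 := h1 _ hp
        rw [minor, Matrix.det_fin_one]
        exact Ideal.subset_span ⟨_, ⟨hrq.2.2 0 0, _, hp, hrq.1 0, hrq.2.1 0⟩, rfl⟩
      · rw [Ideal.span_le]
        rintro _ ⟨v, ⟨hv, ⟨d, c, t⟩, hp, hvd, hvc⟩, rfl⟩
        obtain rfl : t = 1 := h1 _ hp
        refine Ideal.subset_span ⟨_, hp, fun _ => v.1, fun _ => v.2,
          ⟨fun _ => hvd, fun _ => hvc, fun _ _ => hv⟩, ?_⟩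
        rw [minor, Matrix.det_fin_one]
        rfl
    rw [this]
    exact isPrime_span_X_image _
  push Not at h1
  obtain ⟨p₀, hp₀, hp₀t⟩ := h1
  obtain ⟨p, hp, hmax⟩ := Finset.exists_max_image S Corner.t ⟨p₀, hp₀⟩
  have hpt : 2 ≤ p.t := by
    have := hmax p₀ hp₀
    have := ht p₀ hp₀
    omega
  set S' := S.erase p with hS'def
  have hSins : insert p S' = S := Finset.insert_erase hp
  have hS' : IsLadder S' := hS.mono (Finset.erase_subset _ _)
  have ht' : ∀ i ∈ S', 1 ≤ i.t := fun i hi => ht i (Finset.mem_of_mem_erase hi)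
  have hmax' : ∀ i ∈ S', i.t ≤ p.t := fun i hi => hmax i (Finset.mem_of_mem_erase hi)
  have hcmp : ∀ i ∈ S', p.Precedes i ∨ i.Precedes p := fun i hi =>
    hS p hp i (Finset.mem_of_mem_erase hi) (Finset.ne_of_mem_erase hi).symm
  have hsum : p.weight n + ∑ i ∈ S', i.weight n = ∑ i ∈ S, i.weight n :=
    Finset.add_sum_erase S _ hp
  by_cases hvac : p.t ≤ p.d + 1 ∧ (p.d + 1 - p.t, p.c + p.t - 1) ∈ U
  swap
  · have : rankIdeal K U S = rankIdeal K U S' := by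
      refine le_antisymm ?_ ?_ <;> rw [rankIdeal_le_iff] <;> intro i hi
      · by_cases hip : i = p
        · subst hip
          exact containsMinors_of_vacuous hU (ht i hi) hvac _
        · exact containsMinors_rankIdeal (Finset.mem_coe.mpr (Finset.mem_erase.mpr ⟨hip, hi⟩))
      · exact containsMinors_rankIdeal (Finset.mem_of_mem_erase hi)
    rw [this]
    refine ih _ ?_ S' hS' ht' rfl
    have : 0 < p.weight n := Nat.pow_pos (by norm_num)
    omega
  rw [← hSins, Finset.coe_insert]
  clear_value S'
  obtain ⟨d, c, t⟩ := p
  simp only at hpt hmax' hvac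
  obtain ⟨s, rfl⟩ := Nat.exists_eq_add_of_le' hpt
  obtain ⟨hsd, hcorner⟩ := hvac
  obtain ⟨d, rfl⟩ : ∃ e, d = e + 1 := ⟨d - 1, by omega⟩
  have hcn : c + s + 1 ≤ n := by
    have := hn _ hcorner
    simp only at this
    omega
  obtain ⟨k, hk⟩ : ∃ k, n = c + k := ⟨n - c, by omega⟩
  have hw : weight n ⟨d + 1, c, s + 2⟩ = 9 * 3 ^ (d + k) := by
    have : d + 1 + (n + 1 - c) = d + k + 2 := by omega
    rw [weight, this, pow_add]
    ring
  have hw1 : weight n ⟨d, c, s + 2⟩ = 3 * 3 ^ (d + k) := by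
    have : d + (n + 1 - c) = d + k + 1 := by omega
    rw [weight, this, pow_add]
    ring
  have hw2 : weight n ⟨d + 1, c + 1, s + 2⟩ = 3 * 3 ^ (d + k) := by
    have : d + 1 + (n + 1 - (c + 1)) = d + k + 1 := by omega
    rw [weight, this, pow_add]
    ring
  have hw3 : weight n ⟨d, c + 1, s + 1⟩ = 3 ^ (d + k) := by
    have : d + (n + 1 - (c + 1)) = d + k := by omega
    rw [weight, this]
  have hpos : 0 < 3 ^ (d + k) := Nat.pow_pos (by norm_num)
  rw [hw] at hsum
  simp only [Precedes] at hcmp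
  obtain ⟨T₁, hT₁, hST₁, hT₁S, hrow⟩ := hS'.exists_extend K (U := U) ⟨d, c, s + 2⟩ (by
    intro i hi
    have h1 := hmax' i hi
    simp only [Precedes]
    rcases hcmp i hi with h | h
    · exact Or.inl (by omega)
    · by_cases he : i.d + (s + 2) = d + i.t
      · right
        intro I hI
        obtain ⟨e, he'⟩ := Nat.exists_eq_add_of_le h1
        have h2 := hI.add_row e
        rw [← he'] at h2
        exact h2.mono (by omega) h.2.1
      · exact Or.inl (by omega))
  obtain ⟨T, hT, hT₁T, hTT₁, hcol⟩ := hT₁.exists_extend K (U := U) ⟨d + 1, c + 1, s + 2⟩ (by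
    intro i hi
    simp only [Precedes]
    rcases Finset.mem_insert.mp (hT₁S hi) with rfl | hi
    · exact Or.inl (by simp only; omega)
    · have h1 := hmax' i hi
      rcases hcmp i hi with h | h
      · by_cases he : c + 1 + (s + 2) = i.c + i.t
        · right
          intro I hI
          obtain ⟨e, he'⟩ := Nat.exists_eq_add_of_le h1
          have hce : i.c = c + 1 + e := by omega
          rw [hce] at hI
          have h2 := ContainsMinors.add_col e hI
          rw [← he'] at h2
          exact h2.mono h.1 le_rfl
        · exact Or.inl (by omega)
      · exact Or.inl (by omega))
  have hTmem : ∀ i ∈ T, i ∈ S' ∨ i = ⟨d, c, s + 2⟩ ∨ i = ⟨d + 1, c + 1, s + 2⟩ := by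
    intro i hi
    rcases Finset.mem_insert.mp (hTT₁ hi) with h | h
    · exact Or.inr (Or.inr h)
    · rcases Finset.mem_insert.mp (hT₁S h) with h | h
      · exact Or.inr (Or.inl h)
      · exact Or.inl h
  have hTprime : (rankIdeal K U T).IsPrime := by
    refine ih _ ?_ T hT ?_ rfl
    · have h1 := sum_weight_le n hT₁S
      have h2 := sum_weight_le n hTT₁
      omega
    · intro i hi
      rcases hTmem i hi with h | rfl | rfl
      · exact ht' i h
      · exact Nat.succ_pos _
      · exact Nat.succ_pos _
  have hCprime : (rankIdeal K U (insert ⟨d, c + 1, s + 1⟩ (S' : Set Corner))).IsPrime := by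
    rw [← Finset.coe_insert]
    have hlad : IsLadder (insert ⟨d, c + 1, s + 1⟩ S') := hS'.insert fun i hi => by
      have h1 := hmax' i hi
      have h2 := hcmp i hi
      simp only [Precedes]
      omega
    have hpos : ∀ i ∈ insert (⟨d, c + 1, s + 1⟩ : Corner) S', 1 ≤ i.t := by
      intro i hi
      rcases Finset.mem_insert.mp hi with rfl | h
      · exact Nat.succ_pos _
      · exact ht' i h
    have hlt : ∑ i ∈ insert (⟨d, c + 1, s + 1⟩ : Corner) S', i.weight n <
        ∑ i ∈ S, i.weight n := by
      have h1 := sum_weight_le n (subset_refl (insert (⟨d, c + 1, s + 1⟩ : Corner) S'))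
      omega
    exact ih _ hlt _ hlad hpos rfl
  refine isPrime_rankIdeal_insert hU S' T d c s (by omega) ?_ ?_ ?_ (fun i hi => hTmem i hi)
    (Finset.coe_subset.mpr (hST₁.trans hT₁T)) ?_ hcol hTprime hCprime
  · exact hU _ _ _ _ hcorner (by omega) (by omega)
  · intro i hi
    have h1 := hmax' i hi
    have := hcmp i hi
    omega
  · intro i hi
    have h1 := ht' i hi
    have := hcmp i hi
    omega
  · have hle : rankIdeal K U T₁ ≤ rankIdeal K U T :=
      rankIdeal_le_iff.mpr fun i hi => containsMinors_rankIdeal (hT₁T hi)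
    exact fun r q hrq => hle (hrow r q hrq)

theorem minor_comp_perm_mem {K : Type*} [CommRing K] {I : Ideal (MvPolynomial (ℕ × ℕ) K)} {s : ℕ}
    {r q : Fin s → ℕ} (h : minor K r q ∈ I) (σ τ : Equiv.Perm (Fin s)) :
    minor K (r ∘ σ) (q ∘ τ) ∈ I := by
  have h1 := Matrix.det_permute σ ((Matrix.of fun i j => (X (r i, q j) : MvPolynomial (ℕ × ℕ) K)))
  have h2 := Matrix.det_permute' τ
    ((Matrix.of fun i j => (X (r i, q j) : MvPolynomial (ℕ × ℕ) K)).submatrix σ id)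
  have h3 : minor K (r ∘ σ) (q ∘ τ) = (((Matrix.of fun i j =>
      (X (r i, q j) : MvPolynomial (ℕ × ℕ) K)).submatrix σ id).submatrix id τ).det := rfl
  rw [h3, h2, h1]
  exact Ideal.mul_mem_left _ _ (Ideal.mul_mem_left _ _ h)

/-- Strictly increasing rows and columns suffice. -/
theorem containsMinors_of_strictMono {K : Type*} [CommRing K] {U : Set (ℕ × ℕ)} {d c t : ℕ}
    {I : Ideal (MvPolynomial (ℕ × ℕ) K)}
    (h : ∀ r q : Fin t → ℕ, StrictMono r → StrictMono q → InBox U d c r q → minor K r q ∈ I) :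
    ContainsMinors I U d c t := by
  intro r q hrq
  by_cases hr : Function.Injective r
  · by_cases hq : Function.Injective q
    · have h1 := h (r ∘ Tuple.sort r) (q ∘ Tuple.sort q)
        ((Tuple.monotone_sort r).strictMono_of_injective (hr.comp (Equiv.injective _)))
        ((Tuple.monotone_sort q).strictMono_of_injective (hq.comp (Equiv.injective _)))
        ⟨fun _ => hrq.1 _, fun _ => hrq.2.1 _, fun _ _ => hrq.2.2 _ _⟩
      have h2 := minor_comp_perm_mem h1 (Tuple.sort r)⁻¹ (Tuple.sort q)⁻¹
      have h3 : ∀ (f : Fin t → ℕ) (σ : Equiv.Perm (Fin t)), (f ∘ σ) ∘ ⇑σ⁻¹ = f := by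
        intro f σ
        ext i
        simp
      rwa [h3, h3] at h2
    · rw [minor_eq_zero_of_col r q hq]
      exact I.zero_mem
  · rw [minor_eq_zero_of_row r q hr]
    exact I.zero_mem

namespace LadderData

/-- The part of the matrix to the lower left of some upper outside corner. -/
def upperRegion (D : LadderData) : Set (ℕ × ℕ) :=
  {v | ∃ i, D.b i ≤ v.1 ∧ v.2 ≤ D.a i}

theorem mem_Lj_iff (D : LadderData) (j : Fin D.k) (v : ℕ × ℕ) :
    v ∈ D.Lj j ↔ v ∈ D.upperRegion ∧ v.1 ≤ D.d j ∧ D.c j ≤ v.2 := by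
  constructor
  · rintro ⟨⟨i, _, h1, _, _, h2, _⟩, h3⟩
    exact ⟨⟨i, h1, h2⟩, h3⟩
  · rintro ⟨⟨i, h1, h2⟩, h3, h4⟩
    have hb : 1 ≤ D.b i := by
      rw [← D.b_first]
      exact D.b_mono.monotone (Nat.zero_le _)
    have ha : D.a i ≤ D.n := by
      rw [← D.a_last]
      exact D.a_mono.monotone (Nat.le_sub_one_of_lt i.2)
    have hc : 1 ≤ D.c j := by
      rw [← D.c_first]
      exact D.c_mono (Nat.zero_le _)
    have hd : D.d j ≤ D.m := by
      rw [← D.d_last]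
      exact D.d_mono (Nat.le_sub_one_of_lt j.2)
    exact ⟨⟨i, j, h1, h3.trans hd, hc.trans h4, h2, hb.trans h1, h3, h4, h2.trans ha⟩, h3, h4⟩

/-- The rank condition at the `j`-th lower outside corner. -/
def corner (D : LadderData) (j : Fin D.k) : Corner := ⟨D.d j, D.c j, D.t j⟩

theorem corner_precedes (D : LadderData) (e : ℕ) (i : ℕ) (h : i + e + 1 < D.k) :
    (D.corner ⟨i, by omega⟩).Precedes (D.corner ⟨i + e + 1, h⟩) := by
  induction e with
  | zero =>
    exact ⟨D.d_mono (Nat.le_succ _), D.c_mono (Nat.le_succ _), D.step_d i h, D.step_c i h⟩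
  | succ e ih =>
    have h1 := ih (by omega)
    have h2 := D.step_d (i + e + 1) h
    have h3 := D.step_c (i + e + 1) h
    have h4 : D.d ⟨i + e + 1, by omega⟩ ≤ D.d ⟨i + e + 1 + 1, h⟩ := D.d_mono (Nat.le_succ _)
    have h5 : D.c ⟨i + e + 1, by omega⟩ ≤ D.c ⟨i + e + 1 + 1, h⟩ := D.c_mono (Nat.le_succ _)
    simp only [corner, Corner.Precedes, ← add_assoc] at h1 ⊢
    omega

end LadderData

/-- **Theorem (primality).** Every mixed ladder determinantal ideal
`I_t(L) ⊆ K[L]` is a prime ideal. -/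
theorem mixedLadderDeterminantal_isPrime (K : Type*) [Field K]
    (D : LadderData) (hnd : D.Nondeg) :
    (D.It K).IsPrime := by
  classical
  let φ : MvPolynomial D.L K →+* MvPolynomial (ℕ × ℕ) K := (rename Subtype.val).toRingHom
  let ψ : MvPolynomial (ℕ × ℕ) K →+* MvPolynomial D.L K :=
    (aeval fun v => if h : v ∈ D.L then X ⟨v, h⟩ else 0 : _ →ₐ[K] _).toRingHom
  have hψφ : ψ.comp φ = RingHom.id _ := by
    ext v
    · simp [φ, ψ]
    · simp [φ, ψ]
  apply isPrime_of_isPrime_map φ ψ hψφ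
  have hmap : (D.It K).map φ =
      rankIdeal K D.upperRegion ((Finset.univ.image D.corner : Finset Corner) : Set Corner) := by
    have hφ : ∀ {s : ℕ} (r q : Fin s → ℕ) (hmem : ∀ a b, (r a, q b) ∈ D.L),
        φ (Matrix.of fun a b => (X ⟨(r a, q b), hmem a b⟩ : MvPolynomial D.L K)).det =
          minor K r q := by
      intro s r q hmem
      rw [RingHom.map_det, minor]
      refine congrArg Matrix.det ?_
      ext a b : 2
      simp [φ]
    refine le_antisymm ?_ ?_
    · rw [Ideal.map_le_iff_le_comap, LadderData.It]
      refine iSup_le fun j => ?_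
      rw [minorsIdeal, Ideal.span_le]
      rintro _ ⟨r, q, -, -, hS, hmem, rfl⟩
      rw [SetLike.mem_coe, Ideal.mem_comap, hφ]
      simp only [D.mem_Lj_iff] at hS
      refine containsMinors_rankIdeal (p := D.corner j) (by simp) r q
        ⟨fun a => ?_, fun b => ?_, fun a b => (hS a b).1⟩
      · exact (hS a a).2.1
      · exact (hS b b).2.2
    · rw [rankIdeal_le_iff]
      intro p hp
      obtain ⟨j, -, rfl⟩ := Finset.mem_image.mp (Finset.mem_coe.mp hp)
      apply containsMinors_of_strictMono
      intro r q hr hq hrq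
      have hS : ∀ a b, (r a, q b) ∈ D.Lj j := fun a b =>
        (D.mem_Lj_iff j _).mpr ⟨hrq.2.2 a b, hrq.1 a, hrq.2.1 b⟩
      rw [← hφ r q fun a b => (hS a b).1]
      refine Ideal.mem_map_of_mem _ (Ideal.mem_iSup_of_mem j (Ideal.subset_span ?_))
      exact ⟨r, q, hr, hq, hS, fun a b => (hS a b).1, rfl⟩
  rw [hmap]
  refine isPrime_rankIdeal K ?_ D.n ?_ _ ?_ ?_
  · rintro a b a' b' ⟨i, h1, h2⟩ ha hb
    exact ⟨i, h1.trans ha, hb.trans h2⟩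
  · rintro v ⟨i, -, h⟩
    rw [← D.a_last]
    exact h.trans (D.a_mono.monotone (Nat.le_sub_one_of_lt i.2))
  · intro p hp q hq hpq
    obtain ⟨i, -, rfl⟩ := Finset.mem_image.mp hp
    obtain ⟨j, -, rfl⟩ := Finset.mem_image.mp hq
    have hij : (i : ℕ) ≠ j := fun h => hpq (by rw [Fin.ext h])
    rcases Nat.lt_or_gt_of_ne hij with h | h
    · obtain ⟨e, he⟩ := Nat.exists_eq_add_of_lt h
      have := D.corner_precedes e i (he ▸ j.2)
      simp only [← he] at this
      exact Or.inl this
    · obtain ⟨e, he⟩ := Nat.exists_eq_add_of_lt h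
      have := D.corner_precedes e j (he ▸ i.2)
      simp only [← he] at this
      exact Or.inr this
  · intro p hp
    obtain ⟨j, -, rfl⟩ := Finset.mem_image.mp hp
    exact D.t_pos j
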